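/- arXiv:2208.13610 — 2 statements merged into one kernel-verified Lean document; each statement's English description precedes it below -/
import Mathlib

section
/- Let γ = {γ_u} be strictly positive weights satisfying Σ_{j≥1} γ̃_j < ∞, where γ̃_j := max_{v⊆{1,…,j−1}} γ_{v∪{j}}/γ_v. For N = 2^n with n ∈ ℕ, let z = (z_1,…,z_s) be constructed by the CBC-DBD algorithm with weights γ. Then for every δ > 0 there exists a constant C_δ > 0, independent of s and N, such that T_{1,γ}(N,z) ≤ C_δ / N^{1−δ}. -/
open Finset MeasureTheory

noncomputable section

/-- `lsin a = log (1 / sin² (π a))`. -/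
def lsin (a : ℝ) : ℝ := Real.log (1 / Real.sin (Real.pi * a) ^ 2)

/-- The support of `m ∈ ℤ^s`, viewed as a subset of `{1,…,s} ⊂ ℕ`
(component `j : Fin s` corresponds to the index `j+1 ∈ {1,…,s}`). -/
def msupp {s : ℕ} (m : Fin s → ℤ) : Finset ℕ :=
  (Finset.univ.filter fun j => m j ≠ 0).image fun j : Fin s => (j : ℕ) + 1

/-- `r_{α,γ}(m) = γ_{supp(m)}⁻¹ ∏_{j ∈ supp(m)} |m_j|^α`. -/
def rweight {s : ℕ} (α : ℝ) (γ : Finset ℕ → ℝ) (m : Fin s → ℤ) : ℝ :=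
  (γ (msupp m))⁻¹ * ∏ j ∈ Finset.univ.filter (fun j => m j ≠ 0), |(m j : ℝ)| ^ α

/-- The truncated quantity
`T_{α,γ}(N,z) = ∑_{m ∈ M_{N,s}\{0}, m·z ≡ 0 (mod N)} 1 / r_{α,γ}(m)`,
where `M_{N,s} = {-(N-1),…,N-1}^s` and the components of `z` are `z 1, …, z s`. -/
def Tsum (α : ℝ) (γ : Finset ℕ → ℝ) (N s : ℕ) (z : ℕ → ℤ) : ℝ :=
  ∑ m ∈ (Fintype.piFinset fun _ : Fin s => Finset.Icc (-(N : ℤ) + 1) ((N : ℤ) - 1)).filter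
      (fun m => m ≠ 0 ∧ (∑ j : Fin s, m j * z ((j : ℕ) + 1)) % (N : ℤ) = 0),
    1 / rweight α γ m

/-- `H_{s,n,γ}(z) = ∑_{k=1}^{2^n-1} ∑_{∅≠u⊆{1,…,s}} γ_u ∏_{j∈u} log(1/sin²(π k z_j/2^n))`. -/
def Hsum (γ : Finset ℕ → ℝ) (s n : ℕ) (z : ℕ → ℤ) : ℝ :=
  ∑ k ∈ Finset.Icc (1:ℕ) (2 ^ n - 1),
    ∑ u ∈ (Finset.Icc 1 s).powerset.filter (· ≠ ∅),
      γ u * ∏ j ∈ u, lsin ((k : ℝ) * (z j : ℝ) / 2 ^ n)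

/-- The digit-wise quality function `h_{r,n,v,γ}(x)` (with previously chosen
components `z 1, …, z (r-1)`). -/
def hqual (γ : Finset ℕ → ℝ) (n v r : ℕ) (z : ℕ → ℤ) (x : ℤ) : ℝ :=
  ∑ t ∈ Finset.Icc v n, (1 / 2 ^ (t - v) : ℝ) *
    ∑ k ∈ (Finset.Icc (1:ℕ) (2 ^ t - 1)).filter (fun k => Odd k),
      ((∑ u ∈ (Finset.Icc 1 (r - 1)).powerset.filter (· ≠ ∅),
          γ u * ∏ j ∈ u, lsin ((k : ℝ) * (z j : ℝ) / 2 ^ t)) +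
        ∑ u ∈ (Finset.Icc 1 (r - 1)).powerset,
          γ (u ∪ {r}) * lsin ((k : ℝ) * (x : ℝ) / 2 ^ v) *
            ∏ j ∈ u, lsin ((k : ℝ) * (z j : ℝ) / 2 ^ t))

/-- `z = (z 1, …, z s)` is (a possible) output of the component-by-component
digit-by-digit construction (Algorithm 1) with inputs `n`, `s` and weights `γ`:
`z 1 = 1`, and for `r = 2,…,s` one has `z_{r,1} = 1` and for `v = 2,…,n`,
`z_{r,v} = z_{r,v-1} + z* 2^{v-1}` where `z* ∈ {0,1}` minimizes
`z ↦ h_{r,n,v,γ}(z_{r,v-1} + z 2^{v-1})`; finally `z r = z_{r,n}`. -/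
def IsCBCDBD (γ : Finset ℕ → ℝ) (n s : ℕ) (z : ℕ → ℤ) : Prop :=
  z 1 = 1 ∧
  ∃ zz : ℕ → ℕ → ℤ,
    ∀ r ∈ Finset.Icc 2 s, zz r 1 = 1 ∧ z r = zz r n ∧
      ∀ v ∈ Finset.Icc 2 n, ∃ zs ∈ ({0, 1} : Set ℤ),
        zz r v = zz r (v - 1) + zs * 2 ^ (v - 1) ∧
        ∀ w ∈ ({0, 1} : Set ℤ),
          hqual γ n v r z (zz r (v - 1) + zs * 2 ^ (v - 1)) ≤
            hqual γ n v r z (zz r (v - 1) + w * 2 ^ (v - 1))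

/-- The weights `γ ∪ v`, i.e. `(γ ∪ v)_u = γ_{u ∪ v}`. -/
def unionWeights (γ : Finset ℕ → ℝ) (v : Finset ℕ) : Finset ℕ → ℝ :=
  fun u => γ (u ∪ v)

/-- `γ̃_j = max_{v ⊆ {1,…,j-1}} γ_{v ∪ {j}} / γ_v`. -/
def tildeW (γ : Finset ℕ → ℝ) (j : ℕ) : ℝ :=
  (Finset.Icc 1 (j - 1)).powerset.sup' ⟨∅, Finset.empty_mem_powerset _⟩
    fun v => γ (insert j v) / γ v

/-- The unit cube `[0,1]^s`. -/
def cube (s : ℕ) : Set (Fin s → ℝ) := Set.univ.pi fun _ => Set.Icc 0 1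

/-- The Fourier coefficient `f̂(m) = ∫_{[0,1]^s} f(x) e^{-2πi m·x} dx`. -/
def fcoeff (s : ℕ) (f : (Fin s → ℝ) → ℂ) (m : Fin s → ℤ) : ℂ :=
  ∫ x in cube s,
    f x * Complex.exp (-(2 * (Real.pi : ℂ) * Complex.I) * ∑ j, (m j : ℂ) * (x j : ℂ))

/-- The rank-1 lattice rule `Q_{N,s}(f,z) = (1/N) ∑_{k=0}^{N-1} f({k z / N})`. -/
def qmc (N s : ℕ) (z : ℕ → ℤ) (f : (Fin s → ℝ) → ℂ) : ℂ :=
  (N : ℂ)⁻¹ * ∑ k ∈ Finset.range N,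
    f fun j => Int.fract ((k : ℝ) * (z ((j : ℕ) + 1) : ℝ) / (N : ℝ))

/-- The worst-case error `e_{N,s,α,γ}(z)` of the rank-1 lattice rule with generating
vector `z` in the unit ball of the space `E^α_{s,γ}` (whose elements are identified
with their continuous representatives). -/
def wce (N s : ℕ) (α : ℝ) (γ : Finset ℕ → ℝ) (z : ℕ → ℤ) : ℝ :=
  ⨆ f ∈ {f : (Fin s → ℝ) → ℂ |
      Continuous f ∧ ∀ m : Fin s → ℤ, ‖fcoeff s f m‖ * rweight α γ m ≤ 1},
    ‖(∫ x in cube s, f x) - qmc N s z f‖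

/-- For POD weights given by `(Γ_ℓ)` and `(γ_j)`:
`p_{m,ℓ,t}(k) = ∑_{u ⊆ {1,…,m}, |u| = ℓ} Γ_ℓ ∏_{j∈u} γ_j log(1/sin²(π k z_j/2^t))`. -/
def psum (Γ γw : ℕ → ℝ) (z : ℕ → ℤ) (m ℓ t : ℕ) (k : ℕ) : ℝ :=
  ∑ u ∈ (Finset.Icc 1 m).powerset.filter (fun u => u.card = ℓ),
    Γ ℓ * ∏ j ∈ u, γw j * lsin ((k : ℝ) * (z j : ℝ) / 2 ^ t)

lemma lsin_eq (a : ℝ) : lsin a = -2 * Real.log |Real.sin (Real.pi * a)| := by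
  unfold lsin
  rw [one_div, Real.log_inv, Real.log_pow, Real.log_abs]; push_cast; ring

lemma abs_sin_add_int (a : ℝ) (m : ℤ) :
    |Real.sin (Real.pi * (a + m))| = |Real.sin (Real.pi * a)| := by
  rw [mul_add, mul_comm Real.pi (m:ℝ), Real.sin_add_int_mul_pi]
  rw [abs_mul]; simp

lemma lsin_add_int (a : ℝ) (m : ℤ) : lsin (a + m) = lsin a := by
  rw [lsin_eq, lsin_eq, abs_sin_add_int]

lemma lsin_nonneg (a : ℝ) : 0 ≤ lsin a := by
  rw [lsin_eq]
  have := Real.log_nonpos (abs_nonneg _) (Real.abs_sin_le_one (Real.pi * a))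
  linarith

lemma lsin_double (a : ℝ) (h : Real.sin (Real.pi * (2 * a)) ≠ 0) :
    lsin a + lsin (a + 1 / 2) = Real.log 4 + lsin (2 * a) := by
  have e : Real.sin (Real.pi * (2 * a)) = 2 * Real.sin (Real.pi * a) * Real.cos (Real.pi * a) := by
    rw [← Real.sin_two_mul]; ring_nf
  have e2 : Real.sin (Real.pi * (a + 1/2)) = Real.cos (Real.pi * a) := by
    rw [← Real.sin_add_pi_div_two]; ring_nf
  rw [e] at h
  have h1 : Real.sin (Real.pi * a) ≠ 0 := by intro h'; simp [h'] at h
  have h2 : Real.cos (Real.pi * a) ≠ 0 := by intro h'; simp [h'] at h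
  rw [lsin_eq, lsin_eq, lsin_eq, e2, e, abs_mul, abs_mul, Real.log_mul (by positivity) (by positivity),
    Real.log_mul (by positivity) (by positivity)]
  have : Real.log 4 = 2 * Real.log 2 := by
    rw [show (4:ℝ) = 2^2 by norm_num, Real.log_pow]; push_cast; ring
  rw [this, abs_of_pos (by norm_num : (0:ℝ) < 2)]
  ring

lemma sin_lower (x : ℝ) (h0 : 0 < x) (h1 : x < 1) :
    0 < Real.sin (Real.pi * x) ∧ 1 / Real.sin (Real.pi * x) ≤ 1 / (2 * x) + 1 / (2 * (1 - x)) := by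
  have hp := Real.pi_pos
  have key : ∀ y : ℝ, 0 < y → y ≤ 1 / 2 → 2 * y ≤ Real.sin (Real.pi * y) := by
    intro y hy hy2
    have := Real.mul_le_sin (x := Real.pi * y) (by positivity) (by nlinarith)
    calc 2 * y = 2 / Real.pi * (Real.pi * y) := by field_simp
      _ ≤ _ := this
  have hx' : 0 < 1 - x := by linarith
  rcases le_total x (1/2) with h | h
  · have k := key x h0 h
    refine ⟨by linarith, ?_⟩
    have : 1 / Real.sin (Real.pi * x) ≤ 1 / (2 * x) := one_div_le_one_div_of_le (by positivity) k
    have : 0 < 1 / (2 * (1 - x)) := by positivity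
    linarith
  · have k := key (1 - x) hx' (by linarith)
    have e : Real.sin (Real.pi * (1 - x)) = Real.sin (Real.pi * x) := by
      rw [← Real.sin_pi_sub]; ring_nf
    rw [e] at k
    refine ⟨by linarith, ?_⟩
    have : 1 / Real.sin (Real.pi * x) ≤ 1 / (2 * (1 - x)) := one_div_le_one_div_of_le (by positivity) k
    have : 0 < 1 / (2 * x) := by positivity
    linarith

/-- cosine partial sum -/
def Acos (N : ℕ) (x : ℝ) : ℝ :=
  Real.log 4 + 2 * ∑ m ∈ range N, Real.cos (2 * Real.pi * m * x) / m

def cc (m : ℤ) : ℝ := if m = 0 then Real.log 4 else 1 / |(m : ℝ)|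

lemma cc_nonneg (m : ℤ) : 0 ≤ cc m := by
  unfold cc; split_ifs
  · exact Real.log_nonneg (by norm_num)
  · positivity

lemma Acos_complex (N : ℕ) (hN : 1 ≤ N) (x : ℝ) :
    ((Acos N x : ℝ) : ℂ) = ∑ m ∈ Icc (-(N : ℤ) + 1) ((N : ℤ) - 1),
      (cc m : ℂ) * Complex.exp (2 * Real.pi * Complex.I * (m * x)) := by
  induction N, hN using Nat.le_induction with
  | base => simp [Acos, cc]
  | succ N hN ih =>
    have hs : Icc (-((N + 1 : ℕ) : ℤ) + 1) (((N + 1 : ℕ) : ℤ) - 1) =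
        insert (-(N:ℤ)) (insert (N : ℤ) (Icc (-(N : ℤ) + 1) ((N : ℤ) - 1))) := by
      ext a; simp only [mem_Icc, mem_insert]; push_cast; omega
    rw [hs, sum_insert, sum_insert, ← ih]
    · have hA : Acos (N + 1) x = Acos N x + 2 * (Real.cos (2 * Real.pi * N * x) / N) := by
        unfold Acos; rw [sum_range_succ]; ring
      rw [hA]
      have hN' : (N : ℤ) ≠ 0 := by omega
      have hN'' : -(N : ℤ) ≠ 0 := by omega
      simp only [cc, hN', hN'', if_false]
      push_cast
      rw [Complex.cos]
      simp only [abs_neg, Nat.abs_cast]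
      rw [show (2 * (Real.pi:ℂ) * N * x) * Complex.I = 2 * Real.pi * Complex.I * (N * x) by ring,
        show -(2 * (Real.pi:ℂ) * N * x) * Complex.I = 2 * Real.pi * Complex.I * (-N * x) by ring]
      push_cast
      field_simp
      ring
    · simp
    · simp; omega

lemma harm_le (N : ℕ) (hN : 1 ≤ N) : ∑ m ∈ range N, (1:ℝ) / m ≤ 1 + Real.log N := by
  obtain ⟨M, rfl⟩ : ∃ M, N = M + 1 := ⟨N - 1, by omega⟩
  rw [sum_range_succ']
  have := harmonic_le_one_add_log M
  simp only [harmonic] at this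
  push_cast at this ⊢
  simp only [one_div] at *
  have h2 : Real.log M ≤ Real.log (M + 1) := by
    rcases Nat.eq_zero_or_pos M with h | h
    · simp [h]
    · exact Real.log_le_log (by positivity) (by linarith)
  simp only [inv_zero, add_zero]
  linarith

lemma log4_lt : Real.log 4 < 2 := by
  rw [show (4:ℝ) = 2^2 by norm_num, Real.log_pow]; have := Real.log_two_lt_d9; push_cast; linarith
lemma log4_pos : 0 < Real.log 4 := Real.log_pos (by norm_num)

lemma Acos_abs_le (N : ℕ) (hN : 1 ≤ N) (x : ℝ) : |Acos N x| ≤ 4 + 2 * Real.log N := by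
  unfold Acos
  have h1 : |∑ m ∈ range N, Real.cos (2 * Real.pi * m * x) / m| ≤ 1 + Real.log N := by
    refine (abs_sum_le_sum_abs _ _).trans ((sum_le_sum ?_).trans (harm_le N hN))
    intro m _
    rw [abs_div, Nat.abs_cast]
    exact div_le_div_of_nonneg_right (Real.abs_cos_le_one _) (by positivity)
  have := log4_lt; have := log4_pos
  have := abs_le.1 h1
  rw [abs_le]; constructor <;> linarith


lemma tail_fin (N : ℕ) (hN : 1 ≤ N) (w : ℂ) (hw : ‖w‖ ≤ 1) (M : ℕ) :
    ‖(1 - w) * ∑ i ∈ range M, w ^ (i + N) / ((i + N : ℕ) : ℂ) - w ^ N / N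
      + w ^ (N + M) / ((N + M : ℕ) : ℂ)‖ ≤ 1 / N - 1 / ((N + M : ℕ) : ℝ) := by
  induction M with
  | zero => simp
  | succ M ih =>
    have hNM : ((N + M : ℕ) : ℂ) ≠ 0 := by norm_cast; omega
    have hNM1 : ((N + (M + 1) : ℕ) : ℂ) ≠ 0 := by norm_cast
    have e : (1 - w) * ∑ i ∈ range (M + 1), w ^ (i + N) / ((i + N : ℕ) : ℂ) - w ^ N / N
      + w ^ (N + (M + 1)) / ((N + (M + 1) : ℕ) : ℂ) =
      ((1 - w) * ∑ i ∈ range M, w ^ (i + N) / ((i + N : ℕ) : ℂ) - w ^ N / N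
      + w ^ (N + M) / ((N + M : ℕ) : ℂ)) -
        w ^ (N + (M + 1)) * ((1 / ((N + M : ℕ) : ℝ) - 1 / ((N + (M + 1) : ℕ) : ℝ) : ℝ) : ℂ) := by
      rw [sum_range_succ, add_comm M N]
      generalize ∑ i ∈ range M, w ^ (i + N) / ((i + N : ℕ) : ℂ) = S
      rw [Complex.ofReal_sub, Complex.ofReal_div, Complex.ofReal_div, Complex.ofReal_natCast,
        Complex.ofReal_natCast, Complex.ofReal_one]
      rw [show w ^ (N + (M + 1)) = w ^ (N + M) * w by ring]
      field_simp
      ring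
    rw [e]
    refine (norm_sub_le _ _).trans ?_
    have hnn : (0:ℝ) ≤ 1 / ((N + M : ℕ) : ℝ) - 1 / ((N + (M + 1) : ℕ) : ℝ) := by
      rw [sub_nonneg]
      apply one_div_le_one_div_of_le
      · norm_cast; omega
      · norm_cast; omega
    have : ‖w ^ (N + (M + 1)) * ((1 / ((N + M : ℕ) : ℝ) - 1 / ((N + (M + 1) : ℕ) : ℝ) : ℝ) : ℂ)‖
        ≤ 1 / ((N + M : ℕ) : ℝ) - 1 / ((N + (M + 1) : ℕ) : ℝ) := by
      rw [norm_mul, norm_pow, Complex.norm_real, Real.norm_of_nonneg hnn]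
      exact mul_le_of_le_one_left hnn (pow_le_one₀ (norm_nonneg _) hw)
    linarith

lemma tail_fin' (N : ℕ) (hN : 1 ≤ N) (w : ℂ) (hw : ‖w‖ ≤ 1) (M : ℕ) :
    ‖(1 - w) * ∑ i ∈ range M, w ^ (i + N) / ((i + N : ℕ) : ℂ)‖ ≤ 2 / N := by
  have h := tail_fin N hN w hw M
  set X := (1 - w) * ∑ i ∈ range M, w ^ (i + N) / ((i + N : ℕ) : ℂ)
  have h1 : ‖w ^ N / N‖ ≤ 1 / N := by
    rw [norm_div, norm_pow, Complex.norm_natCast]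
    exact div_le_div_of_nonneg_right (pow_le_one₀ (norm_nonneg _) hw) (by positivity)
  have h2 : ‖w ^ (N + M) / ((N + M : ℕ) : ℂ)‖ ≤ 1 / ((N + M : ℕ) : ℝ) := by
    rw [norm_div, norm_pow, Complex.norm_natCast]
    exact div_le_div_of_nonneg_right (pow_le_one₀ (norm_nonneg _) hw) (by positivity)
  have e : X = (X - w ^ N / N + w ^ (N + M) / ((N + M : ℕ) : ℂ)) + w ^ N / N
    - w ^ (N + M) / ((N + M : ℕ) : ℂ) := by ring
  rw [e]
  refine (norm_sub_le _ _).trans ?_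
  have := norm_add_le (X - w ^ N / N + w ^ (N + M) / ((N + M : ℕ) : ℂ)) (w ^ N / N)
  have e3 : (2:ℝ) / N = 1 / N + 1 / N := by ring
  linarith

lemma tail_bound (N : ℕ) (hN : 1 ≤ N) (w : ℂ) (hw : ‖w‖ < 1) :
    ‖(1 - w) * (-Complex.log (1 - w) - ∑ m ∈ range N, w ^ m / m)‖ ≤ 2 / N := by
  have hs := Complex.hasSum_taylorSeries_neg_log hw
  have h1 := (hasSum_nat_add_iff' N).2 hs
  have h2 := ((h1.tendsto_sum_nat).const_mul (1 - w)).norm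
  exact le_of_tendsto h2 (Filter.Eventually.of_forall fun M => tail_fin' N hN w hw.le M)

lemma tail_re (N : ℕ) (hN : 1 ≤ N) (w : ℂ) (hw : ‖w‖ < 1) :
    ‖1 - w‖ * |-Real.log ‖1 - w‖ - (∑ m ∈ range N, w ^ m / m : ℂ).re| ≤ 2 / N := by
  refine le_trans ?_ (tail_bound N hN w hw)
  rw [norm_mul]
  gcongr
  have := Complex.abs_re_le_norm (-Complex.log (1 - w) - ∑ m ∈ range N, w ^ m / m)
  rwa [Complex.sub_re, Complex.neg_re, Complex.log_re] at this

lemma tail_re_circle (N : ℕ) (hN : 1 ≤ N) (w : ℂ) (hw : ‖w‖ = 1) (hw1 : w ≠ 1) :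
    ‖1 - w‖ * |-Real.log ‖1 - w‖ - (∑ m ∈ range N, w ^ m / m : ℂ).re| ≤ 2 / N := by
  let F : ℝ → ℝ := fun ρ => ‖1 - ρ * w‖ * |-Real.log ‖1 - ρ * w‖
    - (∑ m ∈ range N, (ρ * w) ^ m / m : ℂ).re|
  have hne : ‖1 - ((1:ℝ):ℂ) * w‖ ≠ 0 := by
    rw [Complex.ofReal_one, one_mul, norm_ne_zero_iff, sub_ne_zero]; exact hw1.symm
  have hc : ContinuousAt F 1 := by
    have c1 : ContinuousAt (fun ρ : ℝ => ‖1 - (ρ:ℂ) * w‖) 1 := by fun_prop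
    have c2 : ContinuousAt (fun ρ : ℝ => (∑ m ∈ range N, ((ρ:ℂ) * w) ^ m / m : ℂ).re) 1 := by
      fun_prop
    exact c1.mul (((c1.log hne).neg.sub c2).abs)
  have ht : Filter.Tendsto F (nhdsWithin 1 (Set.Iio 1)) (nhds (F 1)) :=
    hc.tendsto.mono_left nhdsWithin_le_nhds
  have hev : ∀ᶠ ρ in nhdsWithin (1:ℝ) (Set.Iio 1), F ρ ≤ 2 / N := by
    have h0 : ∀ᶠ ρ in nhdsWithin (1:ℝ) (Set.Iio 1), ρ ∈ Set.Ioo (0:ℝ) 1 :=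
      Ioo_mem_nhdsLT (by norm_num)
    filter_upwards [h0] with ρ hρ
    apply tail_re N hN
    rw [norm_mul, hw, Complex.norm_real, Real.norm_of_nonneg hρ.1.le, mul_one]
    exact hρ.2
  have := le_of_tendsto ht hev
  simpa [F] using this

lemma Acos_approx (N : ℕ) (hN : 1 ≤ N) (x : ℝ) (hx : Real.sin (Real.pi * x) ≠ 0) :
    |Acos N x - lsin x| ≤ 2 / N * (1 / |Real.sin (Real.pi * x)|) := by
  set w : ℂ := Complex.exp ((2 * Real.pi * x : ℝ) * Complex.I) with hw
  have hw1 : ‖w‖ = 1 := Complex.norm_exp_ofReal_mul_I _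
  have hn : ‖1 - w‖ = 2 * |Real.sin (Real.pi * x)| := by
    rw [norm_sub_rev]
    have := Complex.norm_exp_I_mul_ofReal_sub_one (2 * Real.pi * x)
    rw [mul_comm Complex.I] at this
    rw [hw, this, Real.norm_eq_abs, abs_mul, abs_of_pos (by norm_num : (0:ℝ) < 2)]
    congr 3; ring
  have hsp : 0 < |Real.sin (Real.pi * x)| := by positivity
  have hne : w ≠ 1 := by
    intro h
    rw [h, sub_self, norm_zero] at hn; linarith
  have h := tail_re_circle N hN w hw1 hne
  have hre : (∑ m ∈ range N, w ^ m / m : ℂ).re = ∑ m ∈ range N, Real.cos (2 * Real.pi * m * x) / m := by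
    rw [Complex.re_sum]
    refine sum_congr rfl fun m _ => ?_
    rw [hw, ← Complex.exp_nat_mul, ← Complex.ofReal_natCast, Complex.div_ofReal_re,
      ← mul_assoc, ← Complex.ofReal_mul, Complex.exp_ofReal_mul_I_re]
    congr 2; ring
  rw [hre, hn] at h
  have e : Acos N x - lsin x = -2 * (-Real.log (2 * |Real.sin (Real.pi * x)|)
     - ∑ m ∈ range N, Real.cos (2 * Real.pi * m * x) / m) := by
    rw [lsin_eq, Acos, Real.log_mul (by norm_num) hsp.ne', show (4:ℝ) = 2^2 by norm_num, Real.log_pow]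
    push_cast; ring
  rw [e, abs_mul, abs_neg, abs_of_pos (by norm_num : (0:ℝ) < 2), mul_one_div, le_div_iff₀ hsp]
  linarith


lemma orth (N : ℕ) (hN : 1 ≤ N) (q : ℤ) :
    ∑ k ∈ range N, Complex.exp (2 * Real.pi * Complex.I * (q * (k / N))) =
      if q % (N : ℤ) = 0 then (N : ℂ) else 0 := by
  have hN0 : (N : ℂ) ≠ 0 := by norm_cast; omega
  set w := Complex.exp (2 * Real.pi * Complex.I * (q / N)) with hw
  have hk : ∀ k : ℕ, Complex.exp (2 * Real.pi * Complex.I * (q * (k / N))) = w ^ k := by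
    intro k
    rw [hw, ← Complex.exp_nat_mul]; congr 1; ring
  simp only [hk]
  have hwN : w ^ N = 1 := by
    rw [hw, ← Complex.exp_nat_mul, Complex.exp_eq_one_iff]
    exact ⟨q, by field_simp⟩
  split_ifs with h
  · have : w = 1 := by
      rw [hw, Complex.exp_eq_one_iff]
      obtain ⟨c, hc⟩ := Int.dvd_of_emod_eq_zero h
      refine ⟨c, ?_⟩
      rw [hc]; push_cast; field_simp
    simp [this]
  · have hne : w ≠ 1 := by
      intro h1
      rw [hw, Complex.exp_eq_one_iff] at h1
      obtain ⟨c, hc⟩ := h1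
      apply h
      apply Int.emod_eq_zero_of_dvd
      refine ⟨c, ?_⟩
      have hpi : (2 * Real.pi * Complex.I : ℂ) ≠ 0 := Complex.two_pi_I_ne_zero
      have : (q / N : ℂ) = c := by
        apply mul_left_cancel₀ hpi; rw [hc]; ring
      have : (q : ℂ) = N * c := by field_simp at this; exact this
      exact_mod_cast this
    rw [geom_sum_eq hne, hwN]; simp

def Ysum (N : ℕ) (z : ℕ → ℤ) (u : Finset ℕ) : ℝ :=
  (1 / N) * ∑ k ∈ range N, ∏ j ∈ u, Acos N ((k : ℝ) * z j / N) - Real.log 4 ^ u.card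

lemma dual_sum (N : ℕ) (hN : 1 ≤ N) (z : ℕ → ℤ) (u : Finset ℕ) :
    (1 / N) * ∑ k ∈ range N, ∏ j ∈ u, Acos N ((k : ℝ) * z j / N) =
    ∑ m ∈ (Fintype.piFinset fun _ : u => Icc (-(N : ℤ) + 1) ((N : ℤ) - 1)).filter
      (fun m => (∑ j : u, m j * z j) % (N : ℤ) = 0), ∏ j : u, cc (m j) := by
  have hN0 : (N : ℂ) ≠ 0 := by norm_cast; omega
  have h : (∑ k ∈ range N, ((∏ j ∈ u, Acos N ((k : ℝ) * z j / N) : ℝ) : ℂ)) =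
      ∑ m ∈ (Fintype.piFinset fun _ : u => Icc (-(N : ℤ) + 1) ((N : ℤ) - 1)),
        ((∏ j : u, cc (m j) : ℝ) : ℂ) * (if (∑ j : u, m j * z j) % (N : ℤ) = 0 then (N : ℂ) else 0) := by
    have h1 : ∀ k ∈ range N, ((∏ j ∈ u, Acos N ((k : ℝ) * z j / N) : ℝ) : ℂ) =
        ∑ m ∈ (Fintype.piFinset fun _ : u => Icc (-(N : ℤ) + 1) ((N : ℤ) - 1)),
        ((∏ j : u, cc (m j) : ℝ) : ℂ) *
          Complex.exp (2 * Real.pi * Complex.I * (((∑ j : u, m j * z j : ℤ) : ℂ) * (k / N))) := by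
      intro k _
      rw [Complex.ofReal_prod, ← Finset.prod_coe_sort]
      simp only [Acos_complex N hN]
      rw [Finset.prod_univ_sum]
      refine sum_congr rfl fun m _ => ?_
      rw [prod_mul_distrib, ← Complex.exp_sum, Complex.ofReal_prod]
      congr 2
      push_cast
      rw [Finset.sum_mul, Finset.mul_sum]
      refine sum_congr rfl fun j _ => ?_
      ring
    rw [sum_congr rfl h1, sum_comm]
    refine sum_congr rfl fun m _ => ?_
    rw [← mul_sum, orth N hN]
  apply Complex.ofReal_injective
  rw [Complex.ofReal_mul, Complex.ofReal_sum, h, sum_filter, Complex.ofReal_sum, mul_sum]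
  refine sum_congr rfl fun m _ => ?_
  split_ifs
  · push_cast; field_simp
  · simp

lemma Ysum_eq (N : ℕ) (hN : 1 ≤ N) (z : ℕ → ℤ) (u : Finset ℕ) :
    Ysum N z u = ∑ m ∈ (Fintype.piFinset fun _ : u => Icc (-(N : ℤ) + 1) ((N : ℤ) - 1)).filter
      (fun m => m ≠ 0 ∧ (∑ j : u, m j * z j) % (N : ℤ) = 0), ∏ j : u, cc (m j) := by
  unfold Ysum
  rw [dual_sum N hN]
  have h0 : (0 : u → ℤ) ∈ (Fintype.piFinset fun _ : u => Icc (-(N : ℤ) + 1) ((N : ℤ) - 1)).filter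
      (fun m => (∑ j : u, m j * z j) % (N : ℤ) = 0) := by
    simp; omega
  rw [← add_sum_erase _ _ h0]
  have : ∏ j : u, cc ((0 : u → ℤ) j) = Real.log 4 ^ u.card := by simp [cc]
  rw [this, add_sub_cancel_left]
  refine sum_congr ?_ fun _ _ => rfl
  ext m; simp only [mem_erase, mem_filter]; tauto

lemma Ysum_nonneg (N : ℕ) (hN : 1 ≤ N) (z : ℕ → ℤ) (u : Finset ℕ) : 0 ≤ Ysum N z u := by
  rw [Ysum_eq N hN]
  exact sum_nonneg fun m _ => prod_nonneg fun j _ => cc_nonneg _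

lemma Ysum_empty (N : ℕ) (hN : 1 ≤ N) (z : ℕ → ℤ) : Ysum N z ∅ = 0 := by
  have hN0 : (N : ℝ) ≠ 0 := by norm_cast; omega
  simp [Ysum, hN0]

def extm {s : ℕ} (m : Fin s → ℤ) (j : ℕ) : ℤ :=
  if h : 1 ≤ j ∧ j ≤ s then m ⟨j - 1, by omega⟩ else 0

lemma extm_succ {s : ℕ} (m : Fin s → ℤ) (j : Fin s) : extm m ((j:ℕ) + 1) = m j := by
  unfold extm
  rw [dif_pos ⟨by omega, by have := j.2; omega⟩]
  simp

lemma msupp_sum {s : ℕ} {M : Type*} [AddCommMonoid M] (m : Fin s → ℤ) (f : ℕ → M) :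
    ∑ j ∈ msupp m, f j = ∑ j ∈ univ.filter (fun j => m j ≠ 0), f ((j:ℕ) + 1) := by
  unfold msupp
  rw [sum_image]
  intro a _ b _ h
  simp at h; exact Fin.ext h

lemma msupp_prod {s : ℕ} {M : Type*} [CommMonoid M] (m : Fin s → ℤ) (f : ℕ → M) :
    ∏ j ∈ msupp m, f j = ∏ j ∈ univ.filter (fun j => m j ≠ 0), f ((j:ℕ) + 1) := by
  unfold msupp
  rw [prod_image]
  intro a _ b _ h
  simp at h; exact Fin.ext h

lemma mem_msupp {s : ℕ} (m : Fin s → ℤ) (j : Fin s) : (j:ℕ) + 1 ∈ msupp m ↔ m j ≠ 0 := by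
  unfold msupp
  simp only [mem_image, mem_filter, mem_univ, true_and]
  constructor
  · rintro ⟨a, ha, h⟩
    have : a = j := Fin.ext (by omega)
    rwa [← this]
  · intro h; exact ⟨j, h, rfl⟩

lemma T_le (γ : Finset ℕ → ℝ) (hγ : ∀ u, 0 < γ u) (N s : ℕ) (hN : 1 ≤ N) (z : ℕ → ℤ) :
    Tsum 1 γ N s z ≤ ∑ u ∈ (Icc 1 s).powerset, γ u * Ysum N z u := by
  unfold Tsum
  rw [← sum_fiberwise_of_maps_to (t := (Icc 1 s).powerset) (g := fun m => msupp m)]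
  · refine sum_le_sum fun u hu => ?_
    rw [Ysum_eq N hN, mul_sum]
    set P := ((Fintype.piFinset fun _ : Fin s => Finset.Icc (-(N : ℤ) + 1) ((N : ℤ) - 1)).filter
      (fun m => m ≠ 0 ∧ (∑ j : Fin s, m j * z ((j : ℕ) + 1)) % (N : ℤ) = 0)).filter
        (fun m => msupp m = u) with hP
    let e : (Fin s → ℤ) → (u → ℤ) := fun m j => extm m j
    have hinj : Set.InjOn e P := by
      intro m hm m' hm' h
      simp only [hP, coe_filter, Set.mem_ofPred_eq, mem_filter] at hm hm'
      funext j
      by_cases hj : (j:ℕ) + 1 ∈ u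
      · have := congrFun h ⟨(j:ℕ)+1, hj⟩
        simpa [e, extm_succ] using this
      · have h1 : m j = 0 := by
          by_contra hc; exact hj (hm.2 ▸ (mem_msupp m j).2 hc)
        have h2 : m' j = 0 := by
          by_contra hc; exact hj (hm'.2 ▸ (mem_msupp m' j).2 hc)
        rw [h1, h2]
    have hval : ∀ m ∈ P, 1 / rweight 1 γ m = γ u * ∏ j : u, cc (e m j) := by
      intro m hm
      simp only [hP, mem_filter] at hm
      unfold rweight
      rw [hm.2, prod_coe_sort u (fun j => cc (extm m j)), ← hm.2, msupp_prod, one_div, mul_inv, inv_inv,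
        ← prod_inv_distrib]
      congr 1
      refine prod_congr rfl fun j hj => ?_
      simp only [mem_filter] at hj
      rw [extm_succ, cc, if_neg hj.2, Real.rpow_one, one_div]
    rw [sum_congr rfl hval, ← sum_image (f := fun y : u → ℤ => γ u * ∏ j : u, cc (y j)) hinj]
    refine sum_le_sum_of_subset_of_nonneg ?_ ?_
    · intro y hy
      rw [mem_image] at hy
      obtain ⟨m, hm, rfl⟩ := hy
      simp only [hP, mem_filter, Fintype.mem_piFinset] at hm ⊢
      obtain ⟨⟨hm1, hm2, hm3⟩, hm4⟩ := hm
      refine ⟨?_, ?_, ?_⟩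
      · intro j
        simp only [e, extm]
        split_ifs
        · exact hm1 _
        · simp; omega
      · intro h0
        apply hm2
        funext j
        by_contra hc
        have hj : (j:ℕ) + 1 ∈ u := hm4 ▸ (mem_msupp m j).2 hc
        have := congrFun h0 ⟨(j:ℕ)+1, hj⟩
        simp only [e, extm_succ] at this
        exact hc this
      · rw [← hm3]
        congr 1
        rw [sum_coe_sort u (fun j => extm m j * z j), ← hm4, msupp_sum, sum_filter]
        refine sum_congr rfl fun j _ => ?_
        rw [extm_succ]
        split_ifs with h
        · rfl
        · push Not at h; simp [h]
    · intro y _ _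
      exact mul_nonneg (hγ u).le (prod_nonneg fun j _ => cc_nonneg _)
  · intro m _
    rw [mem_powerset]
    intro j hj
    simp only [msupp, mem_image] at hj
    obtain ⟨a, _, rfl⟩ := hj
    simp


lemma sum_perm (N : ℕ) (hN : 1 ≤ N) (z : ℤ) (hz : IsCoprime z (N : ℤ)) (f : ℤ → ℝ)
    (hf : ∀ q : ℤ, f q = f (q % N)) :
    ∑ k ∈ Icc 1 (N - 1), f ((k : ℤ) * z) = ∑ k ∈ Icc 1 (N - 1), f (k : ℤ) := by
  have hNp : (0 : ℤ) < N := by omega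
  let g : ℕ → ℕ := fun k => (((k : ℤ) * z) % N).toNat
  have hg : ∀ k : ℕ, ((g k : ℕ) : ℤ) = ((k : ℤ) * z) % N := fun k =>
    Int.toNat_of_nonneg (Int.emod_nonneg _ hNp.ne')
  have hmaps : ∀ k ∈ Icc 1 (N - 1), g k ∈ Icc 1 (N - 1) := by
    intro k hk
    rw [mem_Icc] at hk ⊢
    have h1 := hg k
    have h2 : ((k : ℤ) * z) % N < N := Int.emod_lt_of_pos _ hNp
    have h3 : ((k : ℤ) * z) % N ≠ 0 := by
      intro h
      have h4 : (N : ℤ) ∣ k := hz.symm.dvd_of_dvd_mul_right (Int.dvd_of_emod_eq_zero h)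
      have := Int.le_of_dvd (by omega) h4
      omega
    omega
  have hinj : Set.InjOn g (Icc 1 (N - 1) : Finset ℕ) := by
    intro a ha b hb h
    rw [mem_coe, mem_Icc] at ha hb
    have h1 := hg a
    have h2 := hg b
    rw [h] at h1
    have h3 : ((a : ℤ) * z) % N = ((b : ℤ) * z) % N := by rw [← h1, ← h2]
    have h4 : (N : ℤ) ∣ (a : ℤ) * z - b * z := Int.dvd_of_emod_eq_zero (Int.emod_eq_emod_iff_emod_sub_eq_zero.1 h3)
    rw [← sub_mul] at h4
    have h5 : (N : ℤ) ∣ (a : ℤ) - b := hz.symm.dvd_of_dvd_mul_right h4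
    have h6 := Int.eq_zero_of_abs_lt_dvd h5 (by rw [abs_lt]; omega)
    omega
  have hsurj : Set.SurjOn g (Icc 1 (N - 1) : Finset ℕ) (Icc 1 (N - 1) : Finset ℕ) :=
    surjOn_of_injOn_of_card_le g hmaps hinj le_rfl
  refine sum_nbij g hmaps hinj hsurj ?_
  intro k _
  rw [hg, ← hf]

lemma emod_real (N : ℕ) (hN : 1 ≤ N) (q : ℤ) :
    (q : ℝ) / N = ((q % N : ℤ) : ℝ) / N + ((q / N : ℤ) : ℝ) := by
  have hN0 : (N : ℝ) ≠ 0 := by norm_cast; omega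
  have : (q : ℝ) = ((q % N : ℤ) : ℝ) + N * ((q / N : ℤ) : ℝ) := by
    exact_mod_cast (Int.emod_add_mul_ediv q N).symm
  field_simp; linarith

lemma sin_res (N r : ℕ) (h1 : 1 ≤ r) (h2 : r ≤ N - 1) :
    0 < |Real.sin (Real.pi * ((r : ℝ) / N))| ∧
    1 / |Real.sin (Real.pi * ((r : ℝ) / N))| ≤ N / 2 * (1 / r + 1 / ((N - r : ℕ) : ℝ)) := by
  have hN0 : (0 : ℝ) < N := by norm_cast; omega
  have hr0 : (0 : ℝ) < r := by norm_cast
  have hrN : (r : ℝ) < N := by norm_cast; omega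
  have h := sin_lower ((r : ℝ) / N) (by positivity) (by rw [div_lt_one hN0]; exact hrN)
  rw [abs_of_pos h.1]
  refine ⟨h.1, h.2.trans (le_of_eq ?_)⟩
  have e : ((N - r : ℕ) : ℝ) = N - r := by rw [Nat.cast_sub (by omega)]
  rw [e]
  have : (N : ℝ) - r ≠ 0 := by linarith
  field_simp

lemma res_exists (N : ℕ) (hN : 1 ≤ N) (q : ℤ) (hq : ¬ (N : ℤ) ∣ q) :
    ∃ r : ℕ, 1 ≤ r ∧ r ≤ N - 1 ∧ q % N = r := by
  refine ⟨(q % N).toNat, ?_⟩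
  have h0 := Int.emod_nonneg q (show (N : ℤ) ≠ 0 by omega)
  have h1 := Int.emod_lt_of_pos q (show (0 : ℤ) < N by omega)
  have h2 : q % N ≠ 0 := fun h => hq (Int.dvd_of_emod_eq_zero h)
  omega

lemma abs_sin_emod (N : ℕ) (hN : 1 ≤ N) (q : ℤ) :
    |Real.sin (Real.pi * ((q : ℝ) / N))| = |Real.sin (Real.pi * (((q % N : ℤ) : ℝ) / N))| := by
  rw [emod_real N hN q, abs_sin_add_int]

lemma sin_ne (N : ℕ) (hN : 1 ≤ N) (q : ℤ) (hq : ¬ (N : ℤ) ∣ q) :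
    Real.sin (Real.pi * ((q : ℝ) / N)) ≠ 0 := by
  obtain ⟨r, h1, h2, h3⟩ := res_exists N hN q hq
  rw [← abs_pos, abs_sin_emod N hN, h3]
  rw [Int.cast_natCast]
  exact (sin_res N r h1 h2).1

lemma lsin_le (N : ℕ) (hN : 1 ≤ N) (q : ℤ) (hq : ¬ (N : ℤ) ∣ q) :
    lsin ((q : ℝ) / N) ≤ 2 * Real.log N := by
  obtain ⟨r, h1, h2, h3⟩ := res_exists N hN q hq
  rw [lsin_eq, abs_sin_emod N hN, h3]
  obtain ⟨h4, h5⟩ := sin_res N r h1 h2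
  rw [Int.cast_natCast]
  have h6 : 1 / |Real.sin (Real.pi * ((r : ℝ) / N))| ≤ N := by
    refine h5.trans ?_
    have a1 : (1:ℝ) / r ≤ 1 := by
      rw [div_le_one (by norm_cast)]; norm_cast
    have a2 : (1:ℝ) / ((N - r : ℕ) : ℝ) ≤ 1 := by
      rw [div_le_one (by norm_cast; omega)]; norm_cast; omega
    have : (0:ℝ) ≤ N := by positivity
    nlinarith
  have h7 := Real.log_le_log (by positivity) h6
  rw [one_div, Real.log_inv] at h7
  linarith

lemma sum_inv_sin (N : ℕ) (hN : 1 ≤ N) :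
    ∑ k ∈ Icc 1 (N - 1), 2 / (N:ℝ) * (1 / |Real.sin (Real.pi * ((k : ℝ) / N))|) ≤
      2 * (1 + Real.log N) := by
  have hN0 : (0 : ℝ) < N := by norm_cast
  have h1 : ∑ k ∈ Icc 1 (N - 1), 2 / (N:ℝ) * (1 / |Real.sin (Real.pi * ((k : ℝ) / N))|) ≤
      ∑ k ∈ Icc 1 (N - 1), ((1:ℝ) / k + 1 / ((N - k : ℕ) : ℝ)) := by
    refine sum_le_sum fun k hk => ?_
    rw [mem_Icc] at hk
    have := (sin_res N k hk.1 hk.2).2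
    calc _ ≤ 2 / (N:ℝ) * (N / 2 * (1 / k + 1 / ((N - k : ℕ) : ℝ))) := by gcongr
      _ = _ := by field_simp
  have h2 : ∑ k ∈ Icc 1 (N - 1), (1:ℝ) / ((N - k : ℕ) : ℝ) = ∑ k ∈ Icc 1 (N - 1), (1:ℝ) / k := by
    refine sum_nbij' (fun k => N - k) (fun k => N - k) ?_ ?_ ?_ ?_ ?_ <;>
      (intro k hk; simp only [mem_Icc] at hk ⊢)
    all_goals omega
  have h3 : ∑ k ∈ Icc 1 (N - 1), (1:ℝ) / k ≤ 1 + Real.log N := by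
    refine le_trans ?_ (harm_le N hN)
    refine sum_le_sum_of_subset_of_nonneg ?_ fun _ _ _ => by positivity
    intro k hk; rw [mem_Icc] at hk; rw [mem_range]; omega
  rw [sum_add_distrib, h2] at h1
  linarith

lemma prod_diff (u : Finset ℕ) (a b : ℕ → ℝ) (M : ℝ) (hM : 0 ≤ M)
    (ha : ∀ j ∈ u, |a j| ≤ M) (hb : ∀ j ∈ u, |b j| ≤ M) :
    M * |∏ j ∈ u, a j - ∏ j ∈ u, b j| ≤ M ^ u.card * ∑ j ∈ u, |a j - b j| := by
  induction u using Finset.induction_on with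
  | empty => simp
  | insert i u hi ih =>
    have ih := ih (fun j hj => ha j (mem_insert_of_mem hj)) (fun j hj => hb j (mem_insert_of_mem hj))
    rw [prod_insert hi, prod_insert hi, sum_insert hi, card_insert_of_notMem hi]
    have e : a i * ∏ j ∈ u, a j - b i * ∏ j ∈ u, b j =
      (a i - b i) * ∏ j ∈ u, a j + b i * (∏ j ∈ u, a j - ∏ j ∈ u, b j) := by ring
    have h1 : |∏ j ∈ u, a j| ≤ M ^ u.card := by
      rw [abs_prod]
      exact (prod_le_prod (fun _ _ => abs_nonneg _)
        fun j hj => ha j (mem_insert_of_mem hj)).trans (by simp)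
    rw [e]
    have h2 := hb i (mem_insert_self _ _)
    calc _ ≤ M * (|a i - b i| * |∏ j ∈ u, a j| + |b i| * |∏ j ∈ u, a j - ∏ j ∈ u, b j|) := by
          gcongr
          refine (abs_add_le _ _).trans ?_
          rw [abs_mul, abs_mul]
      _ ≤ M * (|a i - b i| * M ^ u.card + M * |∏ j ∈ u, a j - ∏ j ∈ u, b j|) := by gcongr
      _ = M * (|a i - b i| * M ^ u.card) + M * (M * |∏ j ∈ u, a j - ∏ j ∈ u, b j|) := by ring
      _ ≤ M * (|a i - b i| * M ^ u.card) + M * (M ^ u.card * ∑ j ∈ u, |a j - b j|) := by gcongr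
      _ = _ := by ring

def Zsum (N : ℕ) (z : ℕ → ℤ) (u : Finset ℕ) : ℝ :=
  ∑ k ∈ Icc 1 (N - 1), ∏ j ∈ u, lsin ((k : ℝ) * z j / N)

lemma err (N : ℕ) (hN : 1 ≤ N) (z : ℕ → ℤ) (u : Finset ℕ) (hz : ∀ j ∈ u, IsCoprime (z j) (N : ℤ)) :
    |N * (Ysum N z u + Real.log 4 ^ u.card) - Zsum N z u| ≤ (2 * (4 + 4 * Real.log N)) ^ u.card := by
  have hN0 : (0 : ℝ) < N := by norm_cast
  have hL : 0 ≤ Real.log N := Real.log_natCast_nonneg N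
  set R := 4 + 4 * Real.log N with hR
  have hRp : 0 < R := by linarith
  have e : N * (Ysum N z u + Real.log 4 ^ u.card) =
      ∏ j ∈ u, Acos N (((0:ℕ) : ℝ) * z j / N) +
        ∑ k ∈ Icc 1 (N - 1), ∏ j ∈ u, Acos N ((k : ℝ) * z j / N) := by
    unfold Ysum
    rw [sub_add_cancel, ← mul_assoc, mul_one_div_cancel hN0.ne', one_mul]
    have : range N = insert 0 (Icc 1 (N - 1)) := by
      ext k; simp only [mem_range, mem_insert, mem_Icc]; omega
    rw [this, sum_insert (by simp)]
  have hA : ∀ x, |Acos N x| ≤ R := fun x => (Acos_abs_le N hN x).trans (by linarith)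
  have hnd : ∀ k ∈ Icc 1 (N - 1), ∀ j ∈ u, ¬ (N : ℤ) ∣ (k : ℤ) * z j := by
    intro k hk j hj h
    rw [mem_Icc] at hk
    have h4 : (N : ℤ) ∣ k := (hz j hj).symm.dvd_of_dvd_mul_right h
    have := Int.le_of_dvd (by omega) h4
    omega
  have hcast : ∀ (k : ℕ) (j : ℕ), (k : ℝ) * z j / N = (((k : ℤ) * z j : ℤ) : ℝ) / N := by
    intros; push_cast; rfl
  have hl : ∀ k ∈ Icc 1 (N - 1), ∀ j ∈ u, |lsin ((k : ℝ) * z j / N)| ≤ R := by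
    intro k hk j hj
    rw [abs_of_nonneg (lsin_nonneg _), hcast]
    exact (lsin_le N hN _ (hnd k hk j hj)).trans (by linarith)
  have h0 : |∏ j ∈ u, Acos N (((0:ℕ) : ℝ) * z j / N)| ≤ R ^ u.card := by
    rw [abs_prod]
    exact (prod_le_prod (fun _ _ => abs_nonneg _) fun j hj => hA _).trans (by simp)
  have h1 : R * |∑ k ∈ Icc 1 (N - 1), ∏ j ∈ u, Acos N ((k : ℝ) * z j / N) - Zsum N z u| ≤
      R * (u.card * R ^ u.card) := by
    unfold Zsum
    rw [← sum_sub_distrib]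
    calc _ ≤ R * ∑ k ∈ Icc 1 (N - 1), |∏ j ∈ u, Acos N ((k : ℝ) * z j / N) -
            ∏ j ∈ u, lsin ((k : ℝ) * z j / N)| := by
          gcongr; exact abs_sum_le_sum_abs _ _
      _ ≤ ∑ k ∈ Icc 1 (N - 1), R ^ u.card * ∑ j ∈ u,
            |Acos N ((k : ℝ) * z j / N) - lsin ((k : ℝ) * z j / N)| := by
          rw [mul_sum]
          refine sum_le_sum fun k hk => ?_
          exact prod_diff u _ _ R hRp.le (fun j _ => hA _) (hl k hk)
      _ = R ^ u.card * ∑ j ∈ u, ∑ k ∈ Icc 1 (N - 1),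
            |Acos N ((k : ℝ) * z j / N) - lsin ((k : ℝ) * z j / N)| := by
          rw [← mul_sum, sum_comm]
      _ ≤ R ^ u.card * ∑ j ∈ u, R := by
          gcongr with j hj
          calc _ ≤ ∑ k ∈ Icc 1 (N - 1),
              2 / (N:ℝ) * (1 / |Real.sin (Real.pi * ((((k : ℤ) * z j : ℤ) : ℝ) / N))|) := by
                refine sum_le_sum fun k hk => ?_
                rw [hcast]
                exact Acos_approx N hN _ (sin_ne N hN _ (hnd k hk j hj))
            _ = ∑ k ∈ Icc 1 (N - 1),
              2 / (N:ℝ) * (1 / |Real.sin (Real.pi * ((((k : ℤ) : ℤ) : ℝ) / N))|) := by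
                refine sum_perm N hN (z j) (hz j hj)
                  (fun q => 2 / (N:ℝ) * (1 / |Real.sin (Real.pi * ((q : ℝ) / N))|)) ?_
                intro q
                rw [abs_sin_emod N hN q]
            _ ≤ 2 * (1 + Real.log N) := by
                simpa using sum_inv_sin N hN
            _ ≤ R := by linarith
      _ = _ := by rw [sum_const, nsmul_eq_mul]; ring
  have h2 := le_of_mul_le_mul_left h1 hRp
  rw [e, add_sub_assoc]
  refine (abs_add_le _ _).trans ((add_le_add h0 h2).trans ?_)
  rw [mul_pow]
  have : (1 + u.card : ℝ) ≤ 2 ^ u.card := by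
    have := one_add_mul_le_pow (a := (1:ℝ)) (by norm_num) u.card
    norm_num at this; linarith
  have hp : 0 < R ^ u.card := by positivity
  nlinarith


def odds (t : ℕ) : Finset ℕ := (Icc (1:ℕ) (2 ^ t - 1)).filter (fun k => Odd k)

def UU (n v : ℕ) (f : ℕ → ℕ → ℝ) : ℝ :=
  ∑ t ∈ Icc v n, (1 / 2 ^ (t - v) : ℝ) * ∑ k ∈ odds t, f t k

lemma UU_rec (n v : ℕ) (hv : v ≤ n) (f : ℕ → ℕ → ℝ) :
    UU n v f = ∑ k ∈ odds v, f v k + 1 / 2 * UU n (v + 1) f := by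
  unfold UU
  have : Icc v n = insert v (Icc (v + 1) n) := by
    ext a; simp only [mem_Icc, mem_insert]; omega
  rw [this, sum_insert (by simp), Nat.sub_self, mul_sum (Icc (v + 1) n)]
  congr 1
  · simp
  · refine sum_congr rfl fun t ht => ?_
    rw [mem_Icc] at ht
    rw [show t - v = (t - (v + 1)) + 1 by omega, pow_succ]
    field_simp

lemma UU_top (n : ℕ) (f : ℕ → ℕ → ℝ) : UU n n f = ∑ k ∈ odds n, f n k := by
  unfold UU; simp

lemma UU_add (n v : ℕ) (f g : ℕ → ℕ → ℝ) :
    UU n v (fun t k => f t k + g t k) = UU n v f + UU n v g := by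
  unfold UU; simp only [sum_add_distrib, mul_add]

lemma UU_smul (n v : ℕ) (c : ℝ) (f : ℕ → ℕ → ℝ) :
    UU n v (fun t k => c * f t k) = c * UU n v f := by
  unfold UU; simp only [← mul_sum]
  rw [mul_sum]; refine sum_congr rfl fun t _ => by ring

lemma UU_congr (n v : ℕ) (f g : ℕ → ℕ → ℝ) (h : ∀ t k, Odd k → f t k = g t k) :
    UU n v f = UU n v g := by
  unfold UU
  refine sum_congr rfl fun t _ => ?_
  congr 1
  refine sum_congr rfl fun k hk => ?_
  exact h t k (mem_filter.1 hk).2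

lemma UU_nonneg (n v : ℕ) (f : ℕ → ℕ → ℝ) (h : ∀ t k, 0 ≤ f t k) : 0 ≤ UU n v f := by
  unfold UU
  exact sum_nonneg fun t _ => mul_nonneg (by positivity) (sum_nonneg fun k _ => h t k)

lemma lsin_half_odd (k : ℕ) (hk : Odd k) : lsin ((k : ℝ) / 2) = 0 := by
  obtain ⟨c, rfl⟩ := hk
  have : ((2 * c + 1 : ℕ) : ℝ) / 2 = 1 / 2 + ((c : ℤ) : ℝ) := by push_cast; ring
  rw [this, lsin_add_int, lsin_eq, show Real.pi * (1 / 2) = Real.pi / 2 by ring]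
  simp

lemma lsin_pair (v : ℕ) (hv : 1 ≤ v) (k : ℕ) (hk : Odd k) (x : ℤ) (hx : Odd x) :
    lsin ((k : ℝ) * (x : ℝ) / 2 ^ (v + 1)) + lsin ((k : ℝ) * ((x + 2 ^ v : ℤ) : ℝ) / 2 ^ (v + 1)) =
      Real.log 4 + lsin ((k : ℝ) * (x : ℝ) / 2 ^ v) := by
  have h2 : 2 * ((k : ℝ) * (x : ℝ) / 2 ^ (v + 1)) = (k : ℝ) * (x : ℝ) / 2 ^ v := by
    rw [pow_succ]; field_simp
  have h3 : lsin ((k : ℝ) * ((x + 2 ^ v : ℤ) : ℝ) / 2 ^ (v + 1)) =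
      lsin ((k : ℝ) * (x : ℝ) / 2 ^ (v + 1) + 1 / 2) := by
    obtain ⟨c, rfl⟩ := hk
    rw [← lsin_add_int ((((2 * c + 1 : ℕ) : ℝ)) * (x : ℝ) / 2 ^ (v + 1) + 1 / 2) (c : ℤ)]
    congr 1
    push_cast
    rw [pow_succ]; field_simp; ring
  rw [h3, lsin_double, h2]
  rw [h2]
  have := sin_ne (2 ^ v) (Nat.one_le_two_pow) ((k : ℤ) * x) ?_
  · push_cast at this; exact this
  · intro hd
    have h4 : (2 : ℤ) ∣ (k : ℤ) * x := by
      refine dvd_trans ?_ hd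
      push_cast
      exact dvd_pow_self 2 (by omega)
    have h5 : Odd ((k : ℤ) * x) := by
      have : Odd (k : ℤ) := by exact_mod_cast hk
      exact this.mul hx
    rcases h5 with ⟨c, hc⟩
    omega

lemma key_alg (n : ℕ) (hn : 1 ≤ n) (q : ℕ → ℕ → ℝ) (hq : ∀ t k, 0 ≤ q t k) (ζ : ℕ → ℤ)
    (h1 : ζ 1 = 1)
    (hst : ∀ v ∈ Icc 2 n, ∃ zs ∈ ({0, 1} : Set ℤ),
        ζ v = ζ (v - 1) + zs * 2 ^ (v - 1) ∧
        ∀ w ∈ ({0, 1} : Set ℤ),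
          UU n v (fun t k => lsin ((k : ℝ) * ((ζ (v - 1) + zs * 2 ^ (v - 1) : ℤ) : ℝ) / 2 ^ v) * q t k) ≤
          UU n v (fun t k => lsin ((k : ℝ) * ((ζ (v - 1) + w * 2 ^ (v - 1) : ℤ) : ℝ) / 2 ^ v) * q t k)) :
    Odd (ζ n) ∧ ∑ t ∈ Icc 1 n, ∑ k ∈ odds t, lsin ((k : ℝ) * (ζ n : ℝ) / 2 ^ t) * q t k ≤
      Real.log 4 * ∑ t ∈ Icc 1 n, ∑ k ∈ odds t, q t k := by
  have hodd : ∀ v, 1 ≤ v → v ≤ n → Odd (ζ v) := by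
    intro v hv
    induction v, hv using Nat.le_induction with
    | base => intro _; rw [h1]; exact odd_one
    | succ v hv ih =>
      intro hvn
      obtain ⟨zs, _, h, _⟩ := hst (v + 1) (mem_Icc.2 ⟨by omega, hvn⟩)
      rw [h, Nat.add_sub_cancel]
      refine (ih (by omega)).add_even ?_
      refine Even.mul_left ?_ _
      exact (even_two).pow_of_ne_zero (by omega)
  have hcong : ∀ v, 1 ≤ v → ∀ w, v ≤ w → w ≤ n → ∃ c : ℤ, ζ w = ζ v + c * 2 ^ v := by
    intro v hv w hw
    induction w, hw using Nat.le_induction with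
    | base => intro _; exact ⟨0, by simp⟩
    | succ w hw ih =>
      intro hwn
      obtain ⟨c, hc⟩ := ih (by omega)
      obtain ⟨zs, _, h, _⟩ := hst (w + 1) (mem_Icc.2 ⟨by omega, hwn⟩)
      refine ⟨c + zs * 2 ^ (w - v), ?_⟩
      rw [h, Nat.add_sub_cancel, hc, add_mul, mul_assoc, ← pow_add, Nat.sub_add_cancel hw]
      ring
  have hlsin : ∀ v, 1 ≤ v → v ≤ n → ∀ k : ℕ,
      lsin ((k : ℝ) * (ζ n : ℝ) / 2 ^ v) = lsin ((k : ℝ) * (ζ v : ℝ) / 2 ^ v) := by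
    intro v hv hvn k
    obtain ⟨c, hc⟩ := hcong v hv n hvn le_rfl
    rw [← lsin_add_int ((k : ℝ) * (ζ v : ℝ) / 2 ^ v) (k * c), hc]
    congr 1
    push_cast; field_simp
  refine ⟨hodd n hn le_rfl, ?_⟩
  have hclaim : ∀ v, 1 ≤ v → v ≤ n →
      ∑ t ∈ Ico 1 v, ∑ k ∈ odds t, lsin ((k : ℝ) * (ζ n : ℝ) / 2 ^ t) * q t k +
        UU n v (fun t k => lsin ((k : ℝ) * (ζ v : ℝ) / 2 ^ v) * q t k) ≤
      Real.log 4 * (∑ t ∈ Ico 1 v, ∑ k ∈ odds t, q t k + UU n v q) := by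
    intro v hv
    induction v, hv using Nat.le_induction with
    | base =>
      intro _
      have : UU n 1 (fun t k => lsin ((k : ℝ) * (ζ 1 : ℝ) / 2 ^ 1) * q t k) = UU n 1 (fun t k => 0 * q t k) := by
        apply UU_congr
        intro t k hk
        rw [h1]; simp [lsin_half_odd k hk]
      rw [this, UU_smul]
      simp only [Ico_self, sum_empty, zero_mul, zero_add]
      exact mul_nonneg log4_pos.le (UU_nonneg _ _ _ hq)
    | succ v hv ih =>
      intro hvn
      have ih := ih (by omega)
      rw [UU_rec n v (by omega), UU_rec n v (by omega)] at ih
      rw [sum_Ico_succ_top hv, sum_Ico_succ_top hv]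
      simp only [hlsin v hv (by omega)]
      obtain ⟨zs, _, h, hmin⟩ := hst (v + 1) (mem_Icc.2 ⟨by omega, hvn⟩)
      rw [← h] at hmin
      simp only [Nat.add_sub_cancel] at hmin
      have m0 := hmin 0 (by simp)
      have m1 := hmin 1 (by simp)
      simp only [zero_mul, add_zero, one_mul] at m0 m1
      have hp : UU n (v + 1) (fun t k => lsin ((k : ℝ) * (ζ v : ℝ) / 2 ^ (v + 1)) * q t k) +
          UU n (v + 1) (fun t k => lsin ((k : ℝ) * ((ζ v + 2 ^ v : ℤ) : ℝ) / 2 ^ (v + 1)) * q t k) =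
          Real.log 4 * UU n (v + 1) q +
            UU n (v + 1) (fun t k => lsin ((k : ℝ) * (ζ v : ℝ) / 2 ^ v) * q t k) := by
        rw [← UU_smul, ← UU_add, ← UU_add]
        apply UU_congr
        intro t k hk
        rw [← add_mul, ← add_mul, lsin_pair v hv k hk _ (hodd v hv (by omega))]
      linarith
  have := hclaim n hn le_rfl
  rw [UU_top, UU_top] at this
  have hI : Icc 1 n = insert n (Ico 1 n) := by
    ext a; simp only [mem_Icc, mem_insert, mem_Ico]; omega
  rw [hI, sum_insert (by simp), sum_insert (by simp)]
  linarith

lemma group_sum (n : ℕ) (F : ℝ → ℝ) :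
    ∑ k ∈ Icc (1:ℕ) (2 ^ n - 1), F ((k : ℝ) / 2 ^ n) =
      ∑ t ∈ Icc 1 n, ∑ k ∈ odds t, F ((k : ℝ) / 2 ^ t) := by
  induction n with
  | zero => simp
  | succ n ih =>
    rw [sum_Icc_succ_top (by omega), ← ih, ← sum_filter_add_sum_filter_not _ (fun k => Odd k), add_comm]
    congr 1
    symm
    refine sum_nbij (fun k => 2 * k) ?_ ?_ ?_ ?_
    · intro k hk
      simp only [mem_Icc, mem_filter] at hk ⊢
      rw [pow_succ]
      refine ⟨by omega, ?_⟩
      rw [Nat.not_odd_iff_even]; exact even_two_mul k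
    · intro a _ b _ h
      simp at h; exact h
    · intro k hk
      simp only [coe_filter, Set.mem_ofPred_eq, mem_Icc, Nat.not_odd_iff_even] at hk
      obtain ⟨⟨h1, h2⟩, c, rfl⟩ := hk
      rw [pow_succ] at h2
      refine ⟨c, ?_, by simp; ring⟩
      simp only [coe_Icc, Set.mem_Icc]; omega
    · intro k _
      congr 1; push_cast; rw [pow_succ]; field_simp

lemma sum_lsin_one (n : ℕ) :
    ∑ k ∈ range (2 ^ n), lsin ((k : ℝ) / 2 ^ n) ≤ Real.log 4 * (2 ^ n - 1) := by
  induction n with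
  | zero => simp [lsin]
  | succ n ih =>
    have e : 2 ^ (n + 1) = 2 ^ n + 2 ^ n := by ring
    rw [e, sum_range_add, ← sum_add_distrib]
    have h : ∀ k ∈ range (2 ^ n), lsin ((k : ℝ) / 2 ^ (n + 1)) + lsin (((2 ^ n + k : ℕ) : ℝ) / 2 ^ (n + 1))
        ≤ lsin ((k : ℝ) / 2 ^ n) + (if k = 0 then 0 else Real.log 4) := by
      intro k hk
      have e1 : ((2 ^ n + k : ℕ) : ℝ) / 2 ^ (n + 1) = (k : ℝ) / 2 ^ (n + 1) + 1 / 2 := by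
        push_cast; rw [pow_succ]; field_simp; ring
      have e2 : 2 * ((k : ℝ) / 2 ^ (n + 1)) = (k : ℝ) / 2 ^ n := by
        rw [pow_succ]; field_simp
      split_ifs with h0
      · subst h0
        have := lsin_half_odd 1 odd_one
        rw [e1]
        rw [Nat.cast_one] at this
        simp only [Nat.cast_zero, zero_div, zero_add, this]
        linarith [lsin_nonneg 0]
      · rw [e1, lsin_double, e2]
        · linarith
        · rw [e2]
          have := sin_ne (2 ^ n) (Nat.one_le_two_pow) (k : ℤ) ?_
          · push_cast at this; exact this
          · intro hd
            rw [mem_range] at hk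
            have := Nat.le_of_dvd (by omega) (Int.natCast_dvd_natCast.1 hd)
            omega
    have hs := (sum_le_sum h).trans_eq sum_add_distrib
    have hc : ∑ k ∈ range (2 ^ n), (if k = 0 then 0 else Real.log 4) = Real.log 4 * (2 ^ n - 1) := by
      obtain ⟨M, hM⟩ : ∃ M, 2 ^ n = M + 1 := ⟨2 ^ n - 1, by have := Nat.one_le_two_pow (n := n); omega⟩
      have hM' : (2:ℝ) ^ n = M + 1 := by exact_mod_cast hM
      rw [hM, sum_range_succ', hM']; simp; ring
    rw [hc] at hs
    have : (2:ℝ) ^ (n+1) = 2 * 2 ^ n := by ring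
    refine hs.trans ?_
    rw [this]
    have := log4_pos
    nlinarith


lemma alg_step (γ : Finset ℕ → ℝ) (hγ : ∀ u, 0 < γ u) (n s : ℕ) (hn : 1 ≤ n) (z : ℕ → ℤ)
    (h : IsCBCDBD γ n s z) (r : ℕ) (hr : r ∈ Icc 2 s) :
    Odd (z r) ∧ ∑ u ∈ (Icc 1 (r - 1)).powerset, γ (insert r u) * Zsum (2 ^ n) z (insert r u) ≤
      Real.log 4 * ∑ u ∈ (Icc 1 (r - 1)).powerset, γ (insert r u) * Zsum (2 ^ n) z u := by
  obtain ⟨_, zz, hzz⟩ := h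
  obtain ⟨h1, h2, h3⟩ := hzz r hr
  let Q : ℝ → ℝ := fun y => ∑ u ∈ (Icc 1 (r - 1)).powerset, γ (insert r u) * ∏ j ∈ u, lsin (y * z j)
  have hQ : ∀ y, 0 ≤ Q y := fun y => sum_nonneg fun u _ =>
    mul_nonneg (hγ _).le (prod_nonneg fun j _ => lsin_nonneg _)
  have hh : ∀ v x, hqual γ n v r z x =
      UU n v (fun t k => ∑ u ∈ (Finset.Icc 1 (r - 1)).powerset.filter (· ≠ ∅),
          γ u * ∏ j ∈ u, lsin ((k : ℝ) * (z j : ℝ) / 2 ^ t)) +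
      UU n v (fun t k => lsin ((k : ℝ) * (x : ℝ) / 2 ^ v) * Q ((k : ℝ) / 2 ^ t)) := by
    intro v x
    rw [← UU_add]
    unfold hqual UU odds
    refine sum_congr rfl fun t _ => ?_
    congr 1
    refine sum_congr rfl fun k _ => ?_
    congr 1
    simp only [Q]
    rw [mul_sum]
    refine sum_congr rfl fun u _ => ?_
    rw [union_comm, ← insert_eq]
    have : ∀ j, (k : ℝ) * (z j : ℝ) / 2 ^ t = (k : ℝ) / 2 ^ t * z j := fun j => by ring
    simp only [this]
    ring
  have hk := key_alg n hn (fun t k => Q ((k : ℝ) / 2 ^ t)) (fun _ _ => hQ _) (zz r) h1 (by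
    intro v hv
    obtain ⟨zs, hzs, e, hm⟩ := h3 v hv
    refine ⟨zs, hzs, e, fun w hw => ?_⟩
    have := hm w hw
    rw [hh, hh] at this
    linarith)
  rw [← h2] at hk
  refine ⟨hk.1, ?_⟩
  have hk2 := hk.2
  rw [← group_sum n Q] at hk2
  have e1 : ∑ t ∈ Icc 1 n, ∑ k ∈ odds t, lsin ((k : ℝ) * (z r : ℝ) / 2 ^ t) * Q ((k : ℝ) / 2 ^ t) =
      ∑ k ∈ Icc (1:ℕ) (2 ^ n - 1), lsin ((k : ℝ) / 2 ^ n * z r) * Q ((k : ℝ) / 2 ^ n) := by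
    rw [group_sum n (fun y => lsin (y * z r) * Q y)]
    refine sum_congr rfl fun t _ => sum_congr rfl fun k _ => ?_
    congr 2; ring
  rw [e1] at hk2
  have hc : ∀ (k j : ℕ), (k : ℝ) * (z j : ℝ) / ((2 ^ n : ℕ) : ℝ) = (k : ℝ) / 2 ^ n * z j := by
    intro k j; push_cast; ring
  have hnot : ∀ u ∈ (Icc 1 (r - 1)).powerset, r ∉ u := by
    intro u hu hru
    have := mem_Icc.1 (mem_powerset.1 hu hru)
    rw [mem_Icc] at hr
    omega
  have e2 : ∑ u ∈ (Icc 1 (r - 1)).powerset, γ (insert r u) * Zsum (2 ^ n) z (insert r u) =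
      ∑ k ∈ Icc (1:ℕ) (2 ^ n - 1), lsin ((k : ℝ) / 2 ^ n * z r) * Q ((k : ℝ) / 2 ^ n) := by
    simp only [Q, Zsum, mul_sum, hc]
    rw [sum_comm]
    refine sum_congr rfl fun k _ => sum_congr rfl fun u hu => ?_
    rw [prod_insert (hnot u hu)]; ring
  have e3 : ∑ u ∈ (Icc 1 (r - 1)).powerset, γ (insert r u) * Zsum (2 ^ n) z u =
      ∑ k ∈ Icc (1:ℕ) (2 ^ n - 1), Q ((k : ℝ) / 2 ^ n) := by
    simp only [Q, Zsum, mul_sum, hc]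
    rw [sum_comm]
  rw [e2, e3]
  exact hk2

lemma first_step (γ : Finset ℕ → ℝ) (hγ : ∀ u, 0 < γ u) (n : ℕ) (z : ℕ → ℤ) (hz : z 1 = 1) :
    ∑ u ∈ (Icc 1 0).powerset, γ (insert 1 u) * Zsum (2 ^ n) z (insert 1 u) ≤
      Real.log 4 * ∑ u ∈ (Icc 1 0).powerset, γ (insert 1 u) * Zsum (2 ^ n) z u := by
  have h := sum_lsin_one n
  have hp : 1 ≤ 2 ^ n := Nat.one_le_two_pow
  have h2 : ∑ k ∈ Icc (1:ℕ) (2 ^ n - 1), lsin ((k : ℝ) / 2 ^ n) ≤ ∑ k ∈ range (2 ^ n), lsin ((k : ℝ) / 2 ^ n) := by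
    refine sum_le_sum_of_subset_of_nonneg ?_ fun _ _ _ => lsin_nonneg _
    intro k hk; rw [mem_Icc] at hk; rw [mem_range]; omega
  have h3 := (hγ {1}).le
  simp [Zsum, hz]
  rw [mul_left_comm]
  exact mul_le_mul_of_nonneg_left (h2.trans h) h3

lemma tilde_le (γ : Finset ℕ → ℝ) (hγ : ∀ u, 0 < γ u) (r : ℕ) (u : Finset ℕ)
    (hu : u ∈ (Icc 1 r).powerset) : γ (insert (r + 1) u) ≤ tildeW γ (r + 1) * γ u := by
  rw [← div_le_iff₀ (hγ u)]
  exact le_sup' (fun v => γ (insert (r + 1) v) / γ v) hu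

lemma tilde_nonneg (γ : Finset ℕ → ℝ) (hγ : ∀ u, 0 < γ u) (r : ℕ) : 0 ≤ tildeW γ (r + 1) := by
  have := tilde_le γ hγ r ∅ (empty_mem_powerset _)
  have h1 := hγ (insert (r+1) ∅)
  have h2 := hγ ∅
  by_contra hc
  push Not at hc
  nlinarith

lemma powerset_step (r : ℕ) (f : Finset ℕ → ℝ) :
    ∑ u ∈ (Icc 1 (r + 1)).powerset, f u = ∑ u ∈ (Icc 1 r).powerset, f u +
      ∑ u ∈ (Icc 1 r).powerset, f (insert (r + 1) u) := by
  have : Icc 1 (r + 1) = insert (r + 1) (Icc 1 r) := by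
    ext a; simp only [mem_Icc, mem_insert]; omega
  rw [this, sum_powerset_insert (by simp)]

lemma p_bound (γ : Finset ℕ → ℝ) (hγ : ∀ u, 0 < γ u) (h0 : γ ∅ = 1) (B : ℝ) (hB : 0 ≤ B) (r : ℕ) :
    ∑ u ∈ (Icc 1 r).powerset, γ u * B ^ u.card ≤ ∏ j ∈ range r, (1 + B * tildeW γ (j + 1)) := by
  induction r with
  | zero => simp [h0]
  | succ r ih =>
    rw [powerset_step, prod_range_succ]
    have : ∑ u ∈ (Icc 1 r).powerset, γ (insert (r + 1) u) * B ^ (insert (r + 1) u).card ≤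
        B * tildeW γ (r + 1) * ∑ u ∈ (Icc 1 r).powerset, γ u * B ^ u.card := by
      rw [mul_sum]
      refine sum_le_sum fun u hu => ?_
      have hn : r + 1 ∉ u := fun h => by
        have := mem_Icc.1 (mem_powerset.1 hu h); omega
      rw [card_insert_of_notMem hn, pow_succ]
      calc _ ≤ (tildeW γ (r + 1) * γ u) * (B ^ u.card * B) := by
            gcongr; exact tilde_le γ hγ r u hu
        _ = _ := by ring
    have ht := tilde_nonneg γ hγ r
    calc _ ≤ (∑ u ∈ (Icc 1 r).powerset, γ u * B ^ u.card) * (1 + B * tildeW γ (r + 1)) := by linarith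
      _ ≤ _ := by gcongr

set_option maxHeartbeats 2000000 in
lemma main_bound (γ : Finset ℕ → ℝ) (hγ : ∀ u, 0 < γ u) (h0 : γ ∅ = 1) (n s : ℕ) (hn : 1 ≤ n)
    (z : ℕ → ℤ) (h : IsCBCDBD γ n s z) (r : ℕ) (hr : r ≤ s) :
    ((2 ^ n : ℕ) : ℝ) * ∑ u ∈ (Icc 1 r).powerset, γ u * Ysum (2 ^ n) z u ≤
      ∏ j ∈ range r, (1 + 32 * (1 + Real.log ((2 ^ n : ℕ) : ℝ)) * tildeW γ (j + 1)) := by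
  set N : ℕ := 2 ^ n with hN
  have hN1 : 1 ≤ N := Nat.one_le_two_pow
  have hL : 0 ≤ Real.log N := Real.log_natCast_nonneg N
  set B : ℝ := 2 * (4 + 4 * Real.log N) with hB
  have hB8 : 8 ≤ B := by linarith
  have hodd : ∀ j ∈ Icc 1 s, IsCoprime (z j) (N : ℤ) := by
    intro j hj
    have : Odd (z j) := by
      rw [mem_Icc] at hj
      rcases Nat.eq_or_lt_of_le hj.1 with h1 | h1
      · rw [← h1, h.1]; exact odd_one
      · exact (alg_step γ hγ n s hn z h j (mem_Icc.2 ⟨h1, hj.2⟩)).1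
    rw [hN]; push_cast
    apply IsCoprime.pow_right
    obtain ⟨c, hc⟩ := this
    exact ⟨1, -c, by rw [hc]; ring⟩
  induction r with
  | zero => simp [Ysum_empty N hN1]
  | succ r ih =>
    have ih := ih (by omega)
    rw [powerset_step, prod_range_succ]
    have hstep : ∑ u ∈ (Icc 1 r).powerset, γ (insert (r + 1) u) * Zsum N z (insert (r + 1) u) ≤
      Real.log 4 * ∑ u ∈ (Icc 1 r).powerset, γ (insert (r + 1) u) * Zsum N z u := by
      rcases Nat.eq_zero_or_pos r with h1 | h1
      · subst h1; exact first_step γ hγ n z h.1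
      · exact (alg_step γ hγ n s hn z h (r + 1) (mem_Icc.2 ⟨by omega, hr⟩)).2
    set t := tildeW γ (r + 1) with ht
    have ht0 : 0 ≤ t := tilde_nonneg γ hγ r
    have hl4 := log4_lt
    have hl4' := log4_pos
    have hsub : ∀ u ∈ (Icc 1 r).powerset, ∀ j ∈ u, IsCoprime (z j) (N : ℤ) := by
      intro u hu j hj
      have := mem_Icc.1 (mem_powerset.1 hu hj)
      exact hodd j (mem_Icc.2 ⟨by omega, by omega⟩)
    have hA : (N : ℝ) * ∑ u ∈ (Icc 1 r).powerset, γ (insert (r + 1) u) * Ysum N z (insert (r + 1) u) ≤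
        ∑ u ∈ (Icc 1 r).powerset, γ (insert (r + 1) u) * Zsum N z (insert (r + 1) u) +
        ∑ u ∈ (Icc 1 r).powerset, γ (insert (r + 1) u) *
          (B ^ (u.card + 1) - N * Real.log 4 ^ (u.card + 1)) := by
      rw [mul_sum, ← sum_add_distrib]
      refine sum_le_sum fun u hu => ?_
      have hn : r + 1 ∉ u := fun h => by
        have := mem_Icc.1 (mem_powerset.1 hu h); omega
      have he := err N hN1 z (insert (r + 1) u) (by
        intro j hj
        rcases mem_insert.1 hj with h1 | h1
        · exact hodd j (mem_Icc.2 ⟨by omega, by omega⟩)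
        · exact hsub u hu j h1)
      rw [card_insert_of_notMem hn] at he
      have he := (abs_le.1 he).2
      have hg := hγ (insert (r + 1) u)
      rw [mul_left_comm, ← mul_add]
      refine mul_le_mul_of_nonneg_left ?_ hg.le
      linarith
    have hC : Real.log 4 * ∑ u ∈ (Icc 1 r).powerset, γ (insert (r + 1) u) * Zsum N z u +
        ∑ u ∈ (Icc 1 r).powerset, γ (insert (r + 1) u) *
          (B ^ (u.card + 1) - N * Real.log 4 ^ (u.card + 1)) ≤
        ∑ u ∈ (Icc 1 r).powerset, t * γ u * (2 * (N * Ysum N z u) + 2 * B * B ^ u.card) := by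
      rw [mul_sum, ← sum_add_distrib]
      refine sum_le_sum fun u hu => ?_
      have he := (abs_le.1 (err N hN1 z u (hsub u hu))).1
      have hY : 0 ≤ (N : ℝ) * Ysum N z u := mul_nonneg (by positivity) (Ysum_nonneg N hN1 z u)
      have hBp : 0 ≤ B ^ u.card := by positivity
      have hg := hγ (insert (r + 1) u)
      calc _ = γ (insert (r + 1) u) * (Real.log 4 * Zsum N z u +
            (B ^ (u.card + 1) - N * Real.log 4 ^ (u.card + 1))) := by ring
        _ ≤ γ (insert (r + 1) u) * (2 * (N * Ysum N z u) + 2 * B * B ^ u.card) := by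
            refine mul_le_mul_of_nonneg_left ?_ hg.le
            have h1 : Real.log 4 * Zsum N z u ≤
              Real.log 4 * (N * (Ysum N z u + Real.log 4 ^ u.card) + B ^ u.card) := by
              refine mul_le_mul_of_nonneg_left ?_ hl4'.le
              linarith
            have h2 : Real.log 4 * (N * Ysum N z u) ≤ 2 * (N * Ysum N z u) :=
              mul_le_mul_of_nonneg_right hl4.le hY
            have h3 : Real.log 4 * B ^ u.card ≤ B * B ^ u.card :=
              mul_le_mul_of_nonneg_right (by linarith) hBp
            rw [pow_succ, pow_succ]
            linarith
        _ ≤ _ := by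
            refine mul_le_mul_of_nonneg_right (tilde_le γ hγ r u hu) ?_
            positivity
    have hD : ∑ u ∈ (Icc 1 r).powerset, t * γ u * (2 * (N * Ysum N z u) + 2 * B * B ^ u.card) =
        2 * t * (N * ∑ u ∈ (Icc 1 r).powerset, γ u * Ysum N z u) +
        2 * B * t * ∑ u ∈ (Icc 1 r).powerset, γ u * B ^ u.card := by
      simp only [mul_sum]
      rw [← sum_add_distrib]
      refine sum_congr rfl fun u _ => by ring
    have hp := p_bound γ hγ h0 B (by linarith) r
    set P := ∏ j ∈ range r, (1 + 32 * (1 + Real.log N) * tildeW γ (j + 1)) with hP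
    have hpP : ∏ j ∈ range r, (1 + B * tildeW γ (j + 1)) ≤ P := by
      refine prod_le_prod ?_ ?_
      · intro j _
        have := tilde_nonneg γ hγ j
        positivity
      · intro j _
        have := tilde_nonneg γ hγ j
        have : B * tildeW γ (j + 1) ≤ 32 * (1 + Real.log N) * tildeW γ (j + 1) :=
          mul_le_mul_of_nonneg_right (by linarith) this
        linarith
    have hp2 := hp.trans hpP
    have hP0 : 0 ≤ P := by
      refine prod_nonneg fun j _ => ?_
      have := tilde_nonneg γ hγ j
      positivity
    have x1 : 2 * t * (N * ∑ u ∈ (Icc 1 r).powerset, γ u * Ysum N z u) ≤ 2 * t * P := by gcongr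
    have x2 : 2 * B * t * ∑ u ∈ (Icc 1 r).powerset, γ u * B ^ u.card ≤ 2 * B * t * P := by gcongr
    have x3 : 2 * t * P + 2 * B * t * P ≤ P * (32 * (1 + Real.log N) * t) := by
      have : 0 ≤ t * P := by positivity
      have : (2 + 2 * B) * (t * P) ≤ 32 * (1 + Real.log N) * (t * P) :=
        mul_le_mul_of_nonneg_right (by linarith) this
      linarith
    rw [mul_add, mul_add P, mul_one]
    linarith

lemma prod_growth (g : ℕ → ℝ) (hg : ∀ j, 0 ≤ g j) (hs : Summable g) (δ : ℝ) (hδ : 0 < δ) :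
    ∃ C > (0:ℝ), ∀ L : ℝ, 0 ≤ L → ∀ s : ℕ,
      ∏ j ∈ range s, (1 + 32 * (1 + L) * g j) ≤ C * Real.exp (δ * L) := by
  have ht := tendsto_sum_nat_add g
  have hev := (ht.eventually (gt_mem_nhds (show (0:ℝ) < δ / 64 by positivity)))
  obtain ⟨J, hJ⟩ := hev.exists
  set ε : ℝ := δ / (2 * (J + 1)) with hε
  have hε0 : 0 < ε := by positivity
  refine ⟨(∏ j ∈ range J, (1 + 32 * g j / ε)) * Real.exp δ, ?_, ?_⟩
  · have : 0 < ∏ j ∈ range J, (1 + 32 * g j / ε) := prod_pos fun j _ => by have := hg j; positivity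
    positivity
  intro L hL s
  have hnn : ∀ j, 0 ≤ 32 * (1 + L) * g j := fun j => by have := hg j; positivity
  have h1 : ∏ j ∈ range s, (1 + 32 * (1 + L) * g j) ≤ ∏ j ∈ range (J + s), (1 + 32 * (1 + L) * g j) := by
    rw [add_comm J s, prod_range_add]
    refine le_mul_of_one_le_right (prod_nonneg fun j _ => by linarith [hnn j]) ?_
    have := prod_le_prod (s := range J) (f := fun _ => (1:ℝ))
      (g := fun x => 1 + 32 * (1 + L) * g (s + x)) (fun _ _ => zero_le_one)
      (fun j _ => by linarith [hnn (s + j)])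
    simpa using this
  have h2 : ∏ j ∈ range J, (1 + 32 * (1 + L) * g j) ≤
      (∏ j ∈ range J, (1 + 32 * g j / ε)) * Real.exp (δ / 2 * (1 + L)) := by
    have h3 : ∏ j ∈ range J, (1 + 32 * (1 + L) * g j) ≤
        ∏ j ∈ range J, ((1 + 32 * g j / ε) * Real.exp (ε * (1 + L))) := by
      refine prod_le_prod (fun j _ => by linarith [hnn j]) fun j _ => ?_
      have hgj := hg j
      have he : 1 + ε * (1 + L) ≤ Real.exp (ε * (1 + L)) := by
        linarith [Real.add_one_le_exp (ε * (1 + L))]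
      have hq : 0 ≤ 32 * g j / ε := by positivity
      calc 1 + 32 * (1 + L) * g j ≤ (1 + 32 * g j / ε) * (1 + ε * (1 + L)) := by
            have e1 : 32 * g j / ε * (ε * (1 + L)) = 32 * (1 + L) * g j := by field_simp
            have e2 : 0 ≤ ε * (1 + L) := by positivity
            linarith
        _ ≤ _ := by gcongr
    refine h3.trans ?_
    rw [prod_mul_distrib, prod_const, card_range, ← Real.exp_nat_mul]
    have hpp : 0 ≤ ∏ j ∈ range J, (1 + 32 * g j / ε) := prod_nonneg fun j _ => by
      have := hg j; positivity
    refine mul_le_mul_of_nonneg_left (Real.exp_le_exp.2 ?_) hpp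
    have : (J : ℝ) * ε ≤ δ / 2 := by
      rw [hε, mul_div_assoc', div_le_div_iff₀ (by positivity) (by norm_num)]
      nlinarith
    nlinarith
  have h4 : ∏ i ∈ range s, (1 + 32 * (1 + L) * g (J + i)) ≤ Real.exp (δ / 2 * (1 + L)) := by
    calc _ ≤ ∏ i ∈ range s, Real.exp (32 * (1 + L) * g (J + i)) := by
          refine prod_le_prod (fun j _ => by linarith [hnn (J + j)]) fun j _ => ?_
          linarith [Real.add_one_le_exp (32 * (1 + L) * g (J + j))]
      _ = Real.exp (32 * (1 + L) * ∑ i ∈ range s, g (i + J)) := by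
          rw [← Real.exp_sum, mul_sum]
          simp only [add_comm J]
      _ ≤ _ := by
          refine Real.exp_le_exp.2 ?_
          have : ∑ i ∈ range s, g (i + J) ≤ ∑' k, g (k + J) :=
            ((summable_nat_add_iff J).2 hs).sum_le_tsum _ fun i _ => hg _
          have h5 : ∑ i ∈ range s, g (i + J) ≤ δ / 64 := this.trans hJ.le
          have h6 : 32 * (1 + L) * ∑ i ∈ range s, g (i + J) ≤ 32 * (1 + L) * (δ / 64) := by gcongr
          linarith
  rw [prod_range_add] at h1
  refine h1.trans ((mul_le_mul h2 h4 (prod_nonneg fun j _ => by linarith [hnn (J + j)]) ?_).trans (le_of_eq ?_))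
  · refine mul_nonneg (prod_nonneg fun j _ => ?_) (Real.exp_pos _).le
    have := hg j; positivity
  · rw [mul_assoc, mul_assoc, ← Real.exp_add, ← Real.exp_add]
    congr 2; ring

theorem statement10 (γ : Finset ℕ → ℝ) (hγpos : ∀ u, 0 < γ u) (hγempty : γ ∅ = 1)
    (hsum : Summable fun j : ℕ => tildeW γ (j + 1)) :
    ∀ δ > (0 : ℝ), ∃ C > (0 : ℝ),
      ∀ n s : ℕ, 1 ≤ n → 1 ≤ s → ∀ z : ℕ → ℤ, IsCBCDBD γ n s z →
        Tsum 1 γ (2 ^ n) s z ≤ C / ((2 : ℝ) ^ n) ^ (1 - δ) := by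
  intro δ hδ
  obtain ⟨C, hC, hb⟩ := prod_growth _ (fun j => tilde_nonneg γ hγpos j) hsum δ hδ
  refine ⟨C, hC, fun n s hn _ z hz => ?_⟩
  have hN1 : 1 ≤ 2 ^ n := Nat.one_le_two_pow
  have h1 := T_le γ hγpos (2 ^ n) s hN1 z
  have h2 := main_bound γ hγpos hγempty n s hn z hz s le_rfl
  have h3 := h2.trans (hb _ (Real.log_natCast_nonneg (2 ^ n)) s)
  refine h1.trans ?_
  push_cast at h3
  set N : ℝ := 2 ^ n with hN
  have hN0 : 0 < N := by positivity
  rw [mul_comm δ, ← Real.rpow_def_of_pos hN0] at h3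
  rw [le_div_iff₀ (Real.rpow_pos_of_pos hN0 _), Real.rpow_sub hN0, Real.rpow_one, mul_div_assoc',
    div_le_iff₀ (Real.rpow_pos_of_pos hN0 _)]
  linarith

end
end

section
/- Let η = {η_u} be strictly positive weights satisfying Σ_{j≥1} η̃_j < ∞, where η̃_j := max_{v⊆{1,…,j−1}} η_{v∪{j}}/η_v. Then for every α > 1 there exists a constant C_α > 0, independent of s, such that for all s ∈ ℕ, Σ_{∅≠u⊆{1,…,s}} η_u (4ζ(α))^{|u|} ≤ C_α, where ζ is the Riemann zeta function. -/
open Finset MeasureTheory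

noncomputable section

theorem tildeW_nonneg' (η : Finset ℕ → ℝ) (hηpos : ∀ u, 0 < η u) (j : ℕ) : 0 ≤ tildeW η j := by
  unfold tildeW
  refine le_trans ?_ (Finset.le_sup' (fun v => η (insert j v) / η v)
    (Finset.empty_mem_powerset _))
  exact (div_pos (hηpos _) (hηpos _)).le

theorem sum_bound_aux (η : Finset ℕ → ℝ) (hηpos : ∀ u, 0 < η u) (hηempty : η ∅ = 1)
    (x : ℝ) (hx : 0 ≤ x) (s : ℕ) :
    ∑ u ∈ (Finset.Icc 1 s).powerset, η u * x ^ u.card ≤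
      Real.exp (∑ j ∈ Finset.range s, x * tildeW η (j + 1)) := by
  induction s with
  | zero => simp [hηempty]
  | succ s ih =>
    have h1 : Finset.Icc 1 (s + 1) = insert (s + 1) (Finset.Icc 1 s) := by
      ext k; simp only [Finset.mem_insert, Finset.mem_Icc]; omega
    have hn : s + 1 ∉ Finset.Icc 1 s := by simp
    rw [h1, Finset.sum_powerset_insert hn, Finset.sum_range_succ, Real.exp_add]
    have h2 : ∑ u ∈ (Finset.Icc 1 s).powerset,
        η (insert (s + 1) u) * x ^ (insert (s + 1) u).card ≤
        (x * tildeW η (s + 1)) * ∑ u ∈ (Finset.Icc 1 s).powerset, η u * x ^ u.card := by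
      rw [Finset.mul_sum]
      refine Finset.sum_le_sum fun u hu => ?_
      have hu' : s + 1 ∉ u := fun h => hn (Finset.mem_powerset.1 hu h)
      have h3 : η (insert (s + 1) u) / η u ≤ tildeW η (s + 1) := by
        unfold tildeW
        exact Finset.le_sup' (fun v => η (insert (s + 1) v) / η v) (by simpa using hu)
      rw [div_le_iff₀ (hηpos u)] at h3
      rw [Finset.card_insert_of_notMem hu', pow_succ]
      calc _ = η (insert (s + 1) u) * (x ^ u.card * x) := rfl
        _ ≤ (tildeW η (s + 1) * η u) * (x ^ u.card * x) := by gcongr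
        _ = _ := by ring
    have h4 := Real.add_one_le_exp (x * tildeW η (s + 1))
    have h5 : 0 ≤ x * tildeW η (s + 1) := mul_nonneg hx (tildeW_nonneg' η hηpos _)
    calc _ ≤ (∑ u ∈ (Finset.Icc 1 s).powerset, η u * x ^ u.card) * (x * tildeW η (s + 1) + 1) := by
          linarith
      _ ≤ _ := by gcongr

/-- if `∑_{j≥1} η̃_j < ∞`, then for every `α > 1` there is `C_α > 0`,
independent of `s`, with `∑_{∅≠u⊆{1:s}} η_u (4ζ(α))^{|u|} ≤ C_α`. -/
theorem statement12 (η : Finset ℕ → ℝ) (hηpos : ∀ u, 0 < η u) (hηempty : η ∅ = 1)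
    (hsum : Summable fun j : ℕ => tildeW η (j + 1)) :
    ∀ α : ℝ, 1 < α → ∃ C > (0 : ℝ), ∀ s : ℕ, 1 ≤ s →
      ∑ u ∈ (Finset.Icc 1 s).powerset.filter (· ≠ ∅),
        η u * (4 * (riemannZeta (α : ℂ)).re) ^ u.card ≤ C := by
  intro α _
  set a := 4 * (riemannZeta (α : ℂ)).re with ha
  refine ⟨Real.exp (|a| * ∑' j, tildeW η (j + 1)), Real.exp_pos _, fun s _ => ?_⟩
  calc ∑ u ∈ (Finset.Icc 1 s).powerset.filter (· ≠ ∅), η u * a ^ u.card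
      ≤ ∑ u ∈ (Finset.Icc 1 s).powerset.filter (· ≠ ∅), η u * |a| ^ u.card := by
        refine Finset.sum_le_sum fun u _ => ?_
        refine mul_le_mul_of_nonneg_left ?_ (hηpos u).le
        rw [← abs_pow]; exact le_abs_self _
    _ ≤ ∑ u ∈ (Finset.Icc 1 s).powerset, η u * |a| ^ u.card := by
        refine Finset.sum_le_sum_of_subset_of_nonneg (Finset.filter_subset _ _) fun u _ _ => ?_
        exact mul_nonneg (hηpos u).le (pow_nonneg (abs_nonneg a) _)
    _ ≤ Real.exp (∑ j ∈ Finset.range s, |a| * tildeW η (j + 1)) :=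
        sum_bound_aux η hηpos hηempty _ (abs_nonneg a) s
    _ ≤ _ := by
        rw [← Finset.mul_sum]
        refine Real.exp_le_exp.2 (mul_le_mul_of_nonneg_left ?_ (abs_nonneg a))
        exact hsum.sum_le_tsum _ fun j _ => tildeW_nonneg' η hηpos _

end
end
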